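/- The exponential generating function of the truncated exponential-λ-matrix polynomials factorizes as e^{xt}·(1−yt)^{-1}·cos(√t;R): in ℂ[[t]], (Σ_{n≥0} (_eλ_n^R(x,y)/n!) t^n) = (Σ_{n≥0} (x^n/n!) t^n) · (Σ_{k≥0} y^k t^k) · (Σ_{j≥0} (-1)^j c_R(j) t^j/j!), where Σ_{k≥0} y^k t^k is the multiplicative inverse of 1 − yt in ℂ[[t]]. -/

import Mathlib

/-- The coefficients `c_R(j) = Γ(R+j+1)/Γ(2R+2j+1)` (scalar instance of the matrix parameter). -/
noncomputable def cR (R : ℂ) (j : ℕ) : ℂ :=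
  Complex.Gamma (R + j + 1) / Complex.Gamma (2 * R + 2 * j + 1)

/-- The truncated exponential polynomials of order 1:
`e_n(x,y) = n! Σ_{j=0}^n x^{n-j} y^j/(n-j)!`. -/
noncomputable def truncExp (n : ℕ) (x y : ℂ) : ℂ :=
  (n.factorial : ℂ) * ∑ j ∈ Finset.range (n + 1), x ^ (n - j) * y ^ j / ((n - j).factorial : ℂ)

/-- The truncated exponential-λ-matrix polynomials
`_elam_n^R(x,y) = Σ_{j=0}^n (n choose j) (-1)^j c_R(j) e_{n-j}(x,y)`. -/
noncomputable def elam (R : ℂ) (n : ℕ) (x y : ℂ) : ℂ :=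
  ∑ j ∈ Finset.range (n + 1), (n.choose j : ℂ) * (-1) ^ j * cR R j * truncExp (n - j) x y

/-- The exponential generating function of the truncated exponential-λ-matrix polynomials
factorizes as `e^{xt} · (1-yt)^{-1} · cos(√t; R)` in `ℂ[[t]]`, where `Σ_k y^k t^k` is the
multiplicative inverse of `1 - yt`. -/
theorem egf_elam (R : ℂ) (hR : 0 < R.re) (x y : ℂ) :
    (1 - PowerSeries.C y * PowerSeries.X) * PowerSeries.mk (fun k => y ^ k) = 1 ∧
    PowerSeries.mk (fun n => elam R n x y / (n.factorial : ℂ)) =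
      PowerSeries.mk (fun n => x ^ n / (n.factorial : ℂ)) *
        PowerSeries.mk (fun k => y ^ k) *
        PowerSeries.mk (fun j => (-1) ^ j * cR R j / (j.factorial : ℂ)) := by
  have hT : PowerSeries.mk (fun n => x ^ n / (n.factorial : ℂ)) * PowerSeries.mk (fun k => y ^ k)
      = PowerSeries.mk (fun n => truncExp n x y / (n.factorial : ℂ)) := by
    ext n
    have hn : (n.factorial : ℂ) ≠ 0 := by exact_mod_cast n.factorial_ne_zero
    rw [mul_comm, PowerSeries.coeff_mul, Finset.Nat.sum_antidiagonal_eq_sum_range_succ_mk]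
    simp only [PowerSeries.coeff_mk, truncExp]
    rw [mul_div_cancel_left₀ _ hn]
    refine Finset.sum_congr rfl fun j _ => ?_
    ring
  constructor
  · ext n
    rw [sub_mul, one_mul, mul_assoc]
    cases n with
    | zero => simp
    | succ n =>
      rw [map_sub, PowerSeries.coeff_C_mul, PowerSeries.coeff_succ_X_mul]
      simp [PowerSeries.coeff_one, pow_succ, mul_comm]
  · rw [hT]
    ext n
    have hn : (n.factorial : ℂ) ≠ 0 := by exact_mod_cast n.factorial_ne_zero
    rw [mul_comm, PowerSeries.coeff_mul, Finset.Nat.sum_antidiagonal_eq_sum_range_succ_mk]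
    simp only [PowerSeries.coeff_mk, elam]
    rw [Finset.sum_div]
    refine Finset.sum_congr rfl fun j hj => ?_
    have hjn : j ≤ n := Nat.lt_succ_iff.mp (Finset.mem_range.mp hj)
    have h1 : (j.factorial : ℂ) ≠ 0 := by exact_mod_cast j.factorial_ne_zero
    have h2 : ((n - j).factorial : ℂ) ≠ 0 := by exact_mod_cast (n - j).factorial_ne_zero
    rw [Nat.cast_choose ℂ hjn]
    field_simp
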